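/- Let G be a finite simple undirected graph on n vertices with degree sequence d_0 ≥ d_1 ≥ … ≥ d_{n-1}, let s = Σ_{i=0}^{n-1} d_i², and for every index t define δ(t) = Σ_{i=0}^{d_t − 1} d_i (the sum of the d_t largest degrees). Let ℓ be the greatest integer such that Σ_{k=0}^{ℓ} δ(k) < s. Then P_3, the number of ordered pairs of vertices at distance exactly 3, satisfies P_3 ≤ Σ_{k=0}^{ℓ} d_k·δ(k) + d_{ℓ+1}·(s − Σ_{k=0}^{ℓ} δ(k)). -/

import Mathlib

open Finset in
/-- The sum of an antitone function over a finite set of naturals is at most its sum over the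
initial segment of the same size. -/
theorem Antitone.sum_le_sum_range_card {f : ℕ → ℕ} (hf : Antitone f) (T : Finset ℕ) :
    ∑ i ∈ T, f i ≤ ∑ i ∈ range T.card, f i := by
  induction T using Finset.induction_on_max with
  | empty => simp
  | insert a T hlt ih =>
    have ha : a ∉ T := fun h => (hlt a h).false
    have hcard : T.card ≤ a := by
      simpa using card_le_card fun x hx => mem_range.2 (hlt x hx)
    rw [sum_insert ha, card_insert_of_notMem ha, sum_range_succ, add_comm]
    exact add_le_add ih (hf hcard)

open Finset in
/-- Subject to `w ≤ c` and a prescribed total `∑ w`, the sum `∑ d k * w k` with `d` antitone is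
bounded by the value obtained by filling up the capacities `c` greedily from the left. -/
theorem Antitone.sum_mul_le_greedy {d : ℕ → ℕ} (hd : Antitone d) {w c : ℕ → ℕ} (hw : w ≤ c)
    {L N : ℕ} (hLN : L ≤ N) (hc : ∑ k ∈ range L, c k ≤ ∑ k ∈ range N, w k) :
    ∑ k ∈ range N, d k * w k ≤
      ∑ k ∈ range L, d k * c k + d L * (∑ k ∈ range N, w k - ∑ k ∈ range L, c k) := by
  have htail : ∑ k ∈ Ico L N, d k * w k ≤ d L * ∑ k ∈ Ico L N, w k := by
    rw [mul_sum]
    exact sum_le_sum fun k hk => Nat.mul_le_mul_right _ (hd (mem_Ico.1 hk).1)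
  have hhead : ∑ k ∈ range L, (d k * w k + d L * c k) ≤ ∑ k ∈ range L, (d k * c k + d L * w k) := by
    refine sum_le_sum fun k hk => ?_
    have h₁ : d L ≤ d k := hd (mem_range.1 hk).le
    have h₂ : w k ≤ c k := hw k
    nlinarith [mul_le_mul_of_nonneg_left h₂ (Nat.zero_le (d k - d L)), Nat.sub_add_cancel h₁]
  simp only [sum_add_distrib, ← mul_sum] at hhead
  zify [hc]
  rw [← sum_range_add_sum_Ico _ hLN, ← sum_range_add_sum_Ico _ hLN]
  zify at htail hhead
  linarith

namespace SimpleGraph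

variable {V : Type*} [Fintype V] (G : SimpleGraph V) [DecidableRel G.Adj]

open Finset in
/-- The ordered pairs at distance three are at most as numerous as the walks of length three. -/
theorem ncard_edist_eq_three_le :
    {p : V × V | G.edist p.1 p.2 = 3}.ncard ≤
      ∑ u, G.degree u * ∑ v ∈ G.neighborFinset u, G.degree v := by
  classical
  let W : Finset (Σ _ : V, V × Σ _ : V, V) := univ.sigma fun u =>
    G.neighborFinset u ×ˢ (G.neighborFinset u).sigma fun v => G.neighborFinset v
  have hW : W.card = ∑ u, G.degree u * ∑ v ∈ G.neighborFinset u, G.degree v := by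
    simp [W]
  rw [← hW]
  refine le_trans ?_ (card_image_le (s := W) (f := fun t => (t.2.1, t.2.2.2)))
  rw [← Set.ncard_coe_finset]
  refine Set.ncard_le_ncard ?_ (finite_toSet _)
  rintro ⟨x, y⟩ hxy
  obtain ⟨p, hp⟩ := exists_walk_of_edist_eq_coe (k := 3) hxy
  match p, hp with
  | .cons (v := u) hxu (.cons (v := v) huv (.cons hvy .nil)), _ =>
    exact mem_coe.2 (mem_image.2 ⟨⟨u, x, v, y⟩, by simp [W, hxu.symm, huv, hvy], rfl⟩)

/-- Summing the degrees of the neighbors over all vertices gives the sum of squared degrees. -/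
theorem sum_sum_neighborFinset_degree :
    ∑ u, ∑ v ∈ G.neighborFinset u, G.degree v = ∑ v, G.degree v ^ 2 := by
  rw [Finset.sum_comm' (t' := Finset.univ) (s' := fun v => G.neighborFinset v)
    (by simp [G.adj_comm])]
  simp [sq]

end SimpleGraph


/-- **Theorem 1 of the paper.** Let `G` be a finite simple undirected graph on `n` vertices
with degree sequence `d 0 ≥ d 1 ≥ … ≥ d (n-1)` (extended by zero beyond the vertices),
`s = Σ_{i<n} (d i)²`, and `δ t = Σ_{i < d t} d i` (the sum of the `d t` largest degrees).
If `ℓ` is the greatest integer such that `Σ_{k=0}^{ℓ} δ k < s`, then the number `P₃` of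
ordered pairs of vertices at distance exactly `3` satisfies
`P₃ ≤ Σ_{k=0}^{ℓ} d k * δ k + d (ℓ+1) * (s - Σ_{k=0}^{ℓ} δ k)`. -/
theorem bound_on_pairs_at_distance_three
    {V : Type*} [Fintype V] (G : SimpleGraph V) [DecidableRel G.Adj]
    (n : ℕ) (hn : n = Fintype.card V)
    (d : ℕ → ℕ) (e : Fin n ≃ V)
    (hdegseq : ∀ i : Fin n, d i = G.degree (e i))
    (hantitone : ∀ i j : ℕ, i ≤ j → j < n → d j ≤ d i)
    (hzero : ∀ i : ℕ, n ≤ i → d i = 0)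
    (s : ℕ) (hs : s = ∑ i ∈ Finset.range n, (d i) ^ 2)
    (δ : ℕ → ℕ) (hδ : ∀ t, δ t = ∑ i ∈ Finset.range (d t), d i)
    (ℓ : ℕ) (hℓ : ∑ k ∈ Finset.range (ℓ + 1), δ k < s)
    (hℓgreatest : ∀ ℓ' : ℕ, ℓ < ℓ' → ¬ (∑ k ∈ Finset.range (ℓ' + 1), δ k < s)) :
    {p : V × V | G.edist p.1 p.2 = 3}.ncard ≤
      ∑ k ∈ Finset.range (ℓ + 1), d k * δ k +
        d (ℓ + 1) * (s - ∑ k ∈ Finset.range (ℓ + 1), δ k) := by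
  have hd : Antitone d := fun i j hij => by
    rcases lt_or_ge j n with hj | hj
    · exact hantitone i j hij hj
    · simp [hzero j hj]
  have hdeg (v : V) : d (e.symm v) = G.degree v :=
    (hdegseq _).trans (congrArg (fun u => G.degree u) (e.apply_symm_apply v))
  let w : ℕ → ℕ := fun k =>
    if h : k < n then ∑ v ∈ G.neighborFinset (e ⟨k, h⟩), G.degree v else 0
  have hwe (i : Fin n) : w i = ∑ v ∈ G.neighborFinset (e i), G.degree v := by simp [w]
  have hw : w ≤ δ := fun k => by
    rcases lt_or_ge k n with hk | hk
    · let φ : V ↪ ℕ := e.symm.toEmbedding.trans Fin.valEmbedding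
      have h := hd.sum_le_sum_range_card ((G.neighborFinset (e ⟨k, hk⟩)).map φ)
      have hφ (v : V) : d (φ v) = G.degree v := hdeg v
      rw [Finset.sum_map, Finset.card_map, G.card_neighborFinset_eq_degree, ← hdegseq] at h
      simp only [hφ] at h
      rw [hδ]
      exact (hwe ⟨k, hk⟩).trans_le h
    · simp [w, hk.not_gt]
  have hpad (f : ℕ → ℕ) (hf : ∀ k, n ≤ k → f k = 0) :
      ∑ k ∈ Finset.range (max n (ℓ + 1)), f k = ∑ i : Fin n, f i := by
    rw [← Finset.sum_range]
    exact (Finset.sum_subset (by simp) fun k _ hk => hf k (by simpa using hk)).symm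
  have hw0 (k : ℕ) (hk : n ≤ k) : w k = 0 := by simp [w, hk.not_gt]
  have hws : ∑ k ∈ Finset.range (max n (ℓ + 1)), w k = s := by
    rw [hpad w hw0, hs, Finset.sum_range]
    simp only [hwe, hdegseq]
    rw [e.sum_comp fun u => ∑ v ∈ G.neighborFinset u, G.degree v,
      e.sum_comp fun u => G.degree u ^ 2, G.sum_sum_neighborFinset_degree]
  have hdw : ∑ k ∈ Finset.range (max n (ℓ + 1)), d k * w k =
      ∑ u, G.degree u * ∑ v ∈ G.neighborFinset u, G.degree v := by
    rw [hpad _ fun k hk => by simp [hw0 k hk]]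
    simp only [hwe, hdegseq]
    exact e.sum_comp fun u => G.degree u * ∑ v ∈ G.neighborFinset u, G.degree v
  have h := hd.sum_mul_le_greedy hw (le_max_right n (ℓ + 1)) (by rw [hws]; exact hℓ.le)
  rw [hws, hdw] at h
  exact G.ncard_edist_eq_three_le.trans h
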